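/- arXiv:2511.10594 — 3 statements merged into one kernel-verified Lean document; each statement's English description precedes it below -/
import Mathlib

section
/- There is an absolute constant C > 0 with the following property. Let X ≥ 2, let f : ℕ → ℂ be supported on [X/2, 4X] (i.e. f(n) = 0 unless X/2 ≤ n ≤ 4X), let q ≥ 2 be an integer, let T ≥ 2 and T₀ ∈ ℝ. Then Σ_{χ mod q} ∫_{T₀}^{T₀+T} |Σ_{n≥1} f(n) χ(n) n^{−1/2−it}|² dt ≤ C · ((qT + X)/X) · (Σ_{n≥1} |f(n)|²) · (log(qTX))³, where the outer sum runs over all Dirichlet characters χ modulo q. -/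
open MeasureTheory

namespace DirichletMeanValue

open ComplexConjugate

lemma norm_sum_char_mul_conj_le {q : ℕ} [NeZero q] (a b : ZMod q) :
    ‖∑ χ : DirichletCharacter ℂ q, χ a * conj (χ b)‖ ≤ if a = b then (q : ℝ) else 0 := by
  by_cases hb : IsUnit b
  · have h : ∑ χ : DirichletCharacter ℂ q, χ a * conj (χ b) =
        if b = a then (q.totient : ℂ) else 0 := by
      rw [← DirichletCharacter.sum_char_inv_mul_char_eq ℂ hb a]
      refine Finset.sum_congr rfl fun χ _ => ?_
      rw [starRingEnd_apply, MulChar.star_apply', MulChar.inv_apply, mul_comm]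
      obtain ⟨u, rfl⟩ := hb
      rw [Ring.inverse_unit, ZMod.inv_coe_unit]
    rw [h]
    simp only [eq_comm (a := b)]
    split_ifs
    · simpa using Nat.totient_le q
    · simp
  · simp only [MulChar.map_nonunit _ hb, map_zero, mul_zero, Finset.sum_const_zero, norm_zero]
    split_ifs <;> positivity

lemma norm_integral_exp_le_length (l a : ℝ) {T : ℝ} (hT : 0 ≤ T) :
    ‖∫ t in a..(a + T), Complex.exp (Complex.I * l * t)‖ ≤ T := by
  have h := intervalIntegral.norm_integral_le_of_norm_le_const (a := a) (b := a + T) (C := 1)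
    (f := fun t : ℝ => Complex.exp (Complex.I * l * t)) fun t _ => by
      simp [Complex.norm_exp]
  simpa [abs_of_nonneg hT] using h

lemma norm_integral_exp_le_two_div {l : ℝ} (hl : l ≠ 0) (a b : ℝ) :
    ‖∫ t in a..b, Complex.exp (Complex.I * l * t)‖ ≤ 2 / |l| := by
  have hc : Complex.I * (l : ℂ) ≠ 0 := by simp [hl]
  rw [integral_exp_mul_complex hc, norm_div]
  have h1 : ‖Complex.I * (l : ℂ)‖ = |l| := by simp
  rw [h1]
  gcongr
  refine (norm_sub_le _ _).trans ?_
  norm_num [Complex.norm_exp]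

lemma div_le_log_sub_log {m n N : ℕ} (hn : 1 ≤ n) (hnm : n < m) (hmN : m ≤ N) :
    ((m : ℝ) - n) / N ≤ Real.log m - Real.log n := by
  have hn0 : (0 : ℝ) < n := by exact_mod_cast hn
  have hnm' : (n : ℝ) < m := by exact_mod_cast hnm
  have hm0 : (0 : ℝ) < m := hn0.trans hnm'
  have hmN' : (m : ℝ) ≤ N := by exact_mod_cast hmN
  have h := Real.log_le_sub_one_of_pos (div_pos hn0 hm0)
  rw [Real.log_div hn0.ne' hm0.ne'] at h
  have h1 : ((m : ℝ) - n) / N ≤ (m - n) / m :=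
    div_le_div_of_nonneg_left (by linarith) hm0 hmN'
  have h2 : ((m : ℝ) - n) / m = 1 - n / m := by field_simp
  linarith

lemma abs_sub_div_le_abs_log_sub_log {m n N : ℕ} (hm : 1 ≤ m) (hn : 1 ≤ n) (hmN : m ≤ N)
    (hnN : n ≤ N) : |(m : ℝ) - n| / N ≤ |Real.log n - Real.log m| := by
  rcases lt_trichotomy n m with h | rfl | h
  · rw [abs_of_pos (by simpa using h), abs_sub_comm]
    exact (div_le_log_sub_log hn h hmN).trans (le_abs_self _)
  · simp
  · rw [abs_sub_comm, abs_of_pos (by simpa using h)]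
    exact (div_le_log_sub_log hm h hnN).trans (le_abs_self _)

/-- A bound for the contribution of the pair `(m, n)` to the mean square. -/
noncomputable def kernel (q N : ℕ) (T : ℝ) (m n : ℕ) : ℝ :=
  if (m : ZMod q) = n then if m = n then q * T else q * (2 * N / |(m : ℝ) - n|) else 0

lemma kernel_comm (q N : ℕ) (T : ℝ) (m n : ℕ) : kernel q N T m n = kernel q N T n m := by
  unfold kernel
  simp only [eq_comm (a := n), eq_comm (a := (n : ZMod q)), abs_sub_comm (n : ℝ)]

lemma kernel_nonneg (q N : ℕ) {T : ℝ} (hT : 0 ≤ T) (m n : ℕ) : 0 ≤ kernel q N T m n := by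
  unfold kernel
  split_ifs <;> positivity

lemma norm_sum_char_mul_integral_le {q N m n : ℕ} [NeZero q] (a : ℝ) {T : ℝ} (hT : 0 ≤ T)
    (hm : 1 ≤ m) (hn : 1 ≤ n) (hmN : m ≤ N) (hnN : n ≤ N) :
    ‖(∑ χ : DirichletCharacter ℂ q, χ m * conj (χ n)) *
      ∫ t in a..(a + T), Complex.exp (Complex.I * (Real.log n - Real.log m : ℝ) * t)‖ ≤
      kernel q N T m n := by
  have h := norm_sum_char_mul_conj_le (m : ZMod q) n
  rw [norm_mul]
  unfold kernel
  split_ifs at h ⊢ with h1 h2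
  · gcongr
    exact norm_integral_exp_le_length _ _ hT
  · gcongr
    have h3 := abs_sub_div_le_abs_log_sub_log hm hn hmN hnN
    have hN : (0 : ℝ) < N := by exact_mod_cast hm.trans hmN
    have h4 : 0 < |(m : ℝ) - n| := by
      rw [abs_pos, sub_ne_zero]
      exact_mod_cast h2
    have h5 : 0 < |(m : ℝ) - n| / N := by positivity
    refine (norm_integral_exp_le_two_div (abs_pos.1 (h5.trans_le h3)) _ _).trans ?_
    calc 2 / |Real.log n - Real.log m| ≤ 2 / (|(m : ℝ) - n| / N) := by gcongr
      _ = 2 * N / |(m : ℝ) - n| := by field_simp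
  · have : ‖∑ χ : DirichletCharacter ℂ q, χ (m : ZMod q) * conj (χ n)‖ = 0 :=
      le_antisymm h (norm_nonneg _)
    rw [this, zero_mul]

lemma sum_inv_le_of_multiples {q N : ℕ} (hq : 0 < q) (A : Finset ℕ) (d : ℕ → ℕ)
    (hd : Set.InjOn d A) (hA : ∀ n ∈ A, q ∣ d n ∧ 1 ≤ d n ∧ d n ≤ N) :
    ∑ n ∈ A, (d n : ℝ)⁻¹ ≤ (q : ℝ)⁻¹ * (1 + Real.log N) := by
  have hinj : Set.InjOn (fun n => d n / q) A := by
    intro x hx y hy hxy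
    refine hd hx hy ?_
    rw [← Nat.div_mul_cancel (hA x hx).1, ← Nat.div_mul_cancel (hA y hy).1]
    exact congrArg (· * q) hxy
  have hsub : A.image (fun n => d n / q) ⊆ Finset.Icc 1 N := by
    intro k hk
    obtain ⟨n, hn, rfl⟩ := Finset.mem_image.1 hk
    obtain ⟨h1, h2, h3⟩ := hA n hn
    exact Finset.mem_Icc.2 ⟨Nat.div_pos (Nat.le_of_dvd h2 h1) hq, (Nat.div_le_self _ _).trans h3⟩
  calc ∑ n ∈ A, (d n : ℝ)⁻¹ = ∑ n ∈ A, (q : ℝ)⁻¹ * ((d n / q : ℕ) : ℝ)⁻¹ := by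
        refine Finset.sum_congr rfl fun n hn => ?_
        rw [← mul_inv, ← Nat.cast_mul, Nat.mul_div_cancel' (hA n hn).1]
    _ = (q : ℝ)⁻¹ * ∑ k ∈ A.image (fun n => d n / q), (k : ℝ)⁻¹ := by
        rw [Finset.sum_image hinj, Finset.mul_sum]
    _ ≤ (q : ℝ)⁻¹ * ∑ k ∈ Finset.Icc 1 N, (k : ℝ)⁻¹ := by
        gcongr
    _ ≤ (q : ℝ)⁻¹ * (1 + Real.log N) := by
        have h := harmonic_le_one_add_log N
        simp only [harmonic_eq_sum_Icc, Rat.cast_sum, Rat.cast_inv, Rat.cast_natCast] at h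
        gcongr

lemma sum_kernel_le {q N : ℕ} (hq : 0 < q) {T : ℝ} (hT : 0 ≤ T) (S : Finset ℕ)
    (hS : ∀ n ∈ S, n ≤ N) {m : ℕ} (hm : m ≤ N) :
    ∑ n ∈ S, kernel q N T m n ≤ q * T + 4 * N * (1 + Real.log N) := by
  classical
  have hq0 : (q : ℝ) ≠ 0 := by positivity
  set A := S.filter fun n : ℕ => (m : ZMod q) = n ∧ m < n
  set B := S.filter fun n : ℕ => (m : ZMod q) = n ∧ n < m
  have hA : ∑ n ∈ A, ((n - m : ℕ) : ℝ)⁻¹ ≤ (q : ℝ)⁻¹ * (1 + Real.log N) := by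
    refine sum_inv_le_of_multiples hq A (fun n => n - m) ?_ ?_
    · intro x hx y hy hxy
      simp only [A, Finset.coe_filter, Set.mem_ofPred_eq] at hx hy hxy
      omega
    · intro n hn
      obtain ⟨h1, h2, h3⟩ := Finset.mem_filter.1 hn
      have := hS n h1
      exact ⟨(Nat.modEq_iff_dvd' h3.le).1 ((ZMod.natCast_eq_natCast_iff _ _ _).1 h2),
        by omega, by omega⟩
  have hB : ∑ n ∈ B, ((m - n : ℕ) : ℝ)⁻¹ ≤ (q : ℝ)⁻¹ * (1 + Real.log N) := by
    refine sum_inv_le_of_multiples hq B (fun n => m - n) ?_ ?_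
    · intro x hx y hy hxy
      simp only [B, Finset.coe_filter, Set.mem_ofPred_eq] at hx hy hxy
      omega
    · intro n hn
      obtain ⟨h1, h2, h3⟩ := Finset.mem_filter.1 hn
      exact ⟨(Nat.modEq_iff_dvd' h3.le).1 ((ZMod.natCast_eq_natCast_iff _ _ _).1 h2.symm),
        by omega, by omega⟩
  have hpt : ∀ n ∈ S, kernel q N T m n ≤ (if n = m then q * T else 0) +
      2 * q * N * ((if (m : ZMod q) = n ∧ m < n then ((n - m : ℕ) : ℝ)⁻¹ else 0) +
        if (m : ZMod q) = n ∧ n < m then ((m - n : ℕ) : ℝ)⁻¹ else 0) := by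
    intro n _
    unfold kernel
    by_cases h1 : (m : ZMod q) = n
    · rcases lt_trichotomy m n with h | rfl | h
      · have h' : (m : ℝ) - n < 0 := by simpa using h
        simp only [h1, h, h.ne, h.ne', not_lt_of_gt h, if_true, if_false, true_and,
          abs_of_neg h', Nat.cast_sub h.le]
        apply le_of_eq
        rw [neg_sub]
        ring
      · simp
      · have h' : 0 < (m : ℝ) - n := by simpa using h
        simp only [h1, h, h.ne, h.ne', not_lt_of_gt h, if_true, if_false, true_and,
          abs_of_pos h', Nat.cast_sub h.le]
        apply le_of_eq
        ring
    · simp only [h1, if_false, false_and]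
      split_ifs <;> simp
      positivity
  calc ∑ n ∈ S, kernel q N T m n ≤ _ := Finset.sum_le_sum hpt
    _ = (∑ n ∈ S, if n = m then q * T else 0) + 2 * q * N *
        (∑ n ∈ A, ((n - m : ℕ) : ℝ)⁻¹ + ∑ n ∈ B, ((m - n : ℕ) : ℝ)⁻¹) := by
      rw [Finset.sum_add_distrib, ← Finset.mul_sum, Finset.sum_add_distrib, Finset.sum_filter,
        Finset.sum_filter]
    _ ≤ q * T + 2 * q * N *
        ((q : ℝ)⁻¹ * (1 + Real.log N) + (q : ℝ)⁻¹ * (1 + Real.log N)) := by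
      gcongr
      rw [Finset.sum_ite_eq']
      split_ifs
      · exact le_rfl
      · positivity
    _ = q * T + 4 * N * (1 + Real.log N) := by
      field_simp
      ring

lemma sum_sum_mul_le_of_row_sum_le {ι : Type*} (S : Finset ι) (k : ι → ι → ℝ) (x : ι → ℝ) {B : ℝ}
    (hk : ∀ m n, k m n = k n m) (hk0 : ∀ m n, 0 ≤ k m n)
    (hB : ∀ m ∈ S, ∑ n ∈ S, k m n ≤ B) :
    ∑ m ∈ S, ∑ n ∈ S, x m * x n * k m n ≤ B * ∑ m ∈ S, x m ^ 2 := by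
  have h1 : ∑ m ∈ S, ∑ n ∈ S, x m ^ 2 * k m n ≤ B * ∑ m ∈ S, x m ^ 2 := by
    rw [Finset.mul_sum]
    refine Finset.sum_le_sum fun m hm => ?_
    rw [← Finset.mul_sum, mul_comm]
    exact mul_le_mul_of_nonneg_right (hB m hm) (sq_nonneg _)
  have h2 : ∑ m ∈ S, ∑ n ∈ S, x n ^ 2 * k m n = ∑ m ∈ S, ∑ n ∈ S, x m ^ 2 * k m n := by
    rw [Finset.sum_comm]
    simp only [hk]
  have h3 : ∑ m ∈ S, ∑ n ∈ S, x m * x n * k m n ≤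
      ∑ m ∈ S, ∑ n ∈ S, (1 / 2 * (x m ^ 2 * k m n) + 1 / 2 * (x n ^ 2 * k m n)) := by
    refine Finset.sum_le_sum fun m _ => Finset.sum_le_sum fun n _ => ?_
    nlinarith [mul_nonneg (sq_nonneg (x m - x n)) (hk0 m n)]
  simp only [Finset.sum_add_distrib, ← Finset.mul_sum] at h3
  simp only [← Finset.mul_sum] at h1 h2
  linarith

lemma ofReal_sum_integral_norm_sq {q : ℕ} [NeZero q] (S : Finset ℕ) (c : ℕ → ℂ) (a b : ℝ) :
    ((∑ χ : DirichletCharacter ℂ q, ∫ t in a..b,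
      ‖∑ n ∈ S, c n * χ n * Complex.exp (-Complex.I * Real.log n * t)‖ ^ 2 : ℝ) : ℂ) =
    ∑ m ∈ S, ∑ n ∈ S, c m * conj (c n) *
      ((∑ χ : DirichletCharacter ℂ q, χ m * conj (χ n)) *
        ∫ t in a..b, Complex.exp (Complex.I * (Real.log n - Real.log m : ℝ) * t)) := by
  have h : ∀ χ : DirichletCharacter ℂ q, ((∫ t in a..b,
      ‖∑ n ∈ S, c n * χ n * Complex.exp (-Complex.I * Real.log n * t)‖ ^ 2 : ℝ) : ℂ) =
      ∑ m ∈ S, ∑ n ∈ S, c m * conj (c n) * ((χ m * conj (χ n)) *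
        ∫ t in a..b, Complex.exp (Complex.I * (Real.log n - Real.log m : ℝ) * t)) := by
    intro χ
    rw [← intervalIntegral.integral_ofReal]
    have h1 : ∀ t : ℝ,
        ((‖∑ n ∈ S, c n * χ n * Complex.exp (-Complex.I * Real.log n * t)‖ ^ 2 : ℝ) : ℂ) =
        ∑ m ∈ S, ∑ n ∈ S, c m * conj (c n) * (χ m * conj (χ n)) *
          Complex.exp (Complex.I * (Real.log n - Real.log m : ℝ) * t) := by
      intro t
      rw [Complex.ofReal_pow, ← Complex.mul_conj', map_sum, Finset.sum_mul_sum]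
      refine Finset.sum_congr rfl fun m _ => Finset.sum_congr rfl fun n _ => ?_
      have h2 : Complex.exp (Complex.I * (Real.log n - Real.log m : ℝ) * t) =
          Complex.exp (-Complex.I * Real.log m * t) *
            conj (Complex.exp (-Complex.I * Real.log n * t)) := by
        rw [← Complex.exp_conj, ← Complex.exp_add]
        congr 1
        simp only [map_mul, map_neg, Complex.conj_I, Complex.conj_ofReal]
        push_cast
        ring
      rw [h2]
      simp only [map_mul]
      ring
    simp only [h1]
    rw [intervalIntegral.integral_finsetSum fun m _ =>
      (Continuous.intervalIntegrable (by fun_prop) _ _)]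
    refine Finset.sum_congr rfl fun m _ => ?_
    rw [intervalIntegral.integral_finsetSum fun n _ =>
      (Continuous.intervalIntegrable (by fun_prop) _ _)]
    refine Finset.sum_congr rfl fun n _ => ?_
    rw [intervalIntegral.integral_const_mul, mul_assoc]
  rw [Complex.ofReal_sum]
  simp only [h]
  rw [Finset.sum_comm]
  refine Finset.sum_congr rfl fun m _ => ?_
  rw [Finset.sum_comm]
  refine Finset.sum_congr rfl fun n _ => ?_
  rw [← Finset.mul_sum, ← Finset.sum_mul]

theorem sum_integral_norm_sq_le {q N : ℕ} [NeZero q] (S : Finset ℕ)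
    (hS : ∀ n ∈ S, 1 ≤ n ∧ n ≤ N) (c : ℕ → ℂ) (a : ℝ) {T : ℝ} (hT : 0 ≤ T) :
    ∑ χ : DirichletCharacter ℂ q, ∫ t in a..(a + T),
      ‖∑ n ∈ S, c n * χ n * Complex.exp (-Complex.I * Real.log n * t)‖ ^ 2 ≤
    (q * T + 4 * N * (1 + Real.log N)) * ∑ n ∈ S, ‖c n‖ ^ 2 := by
  refine (Real.le_norm_self _).trans ?_
  rw [← Complex.norm_real, ofReal_sum_integral_norm_sq]
  refine le_trans ?_ (sum_sum_mul_le_of_row_sum_le S (kernel q N T) (fun n => ‖c n‖)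
    (kernel_comm q N T) (kernel_nonneg q N hT) fun m hm =>
      sum_kernel_le (NeZero.pos q) hT S (fun n hn => (hS n hn).2) (hS m hm).2)
  refine norm_sum_le_of_le _ fun m hm => norm_sum_le_of_le _ fun n hn => ?_
  rw [norm_mul, norm_mul, RCLike.norm_conj]
  gcongr
  exact norm_sum_char_mul_integral_le a hT (hS m hm).1 (hS n hn).1 (hS m hm).2 (hS n hn).2

lemma natCast_cpow_neg_half_sub {n : ℕ} (hn : n ≠ 0) (t : ℝ) :
    (n : ℂ) ^ (-(1 / 2 : ℂ) - Complex.I * t) =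
      (n : ℂ) ^ (-(1 / 2 : ℂ)) * Complex.exp (-Complex.I * Real.log n * t) := by
  have hn' : (n : ℂ) ≠ 0 := by exact_mod_cast hn
  rw [sub_eq_add_neg, Complex.cpow_add _ _ hn', Complex.cpow_def_of_ne_zero hn' (-(_ * _)),
    Complex.natCast_log]
  congr 2
  ring

lemma norm_sq_mul_natCast_cpow_neg_half (z : ℂ) {n : ℕ} (hn : 0 < n) :
    ‖z * (n : ℂ) ^ (-(1 / 2 : ℂ))‖ ^ 2 = ‖z‖ ^ 2 / n := by
  have hn' : (0 : ℝ) < n := by exact_mod_cast hn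
  rw [norm_mul, mul_pow, Complex.norm_natCast_cpow_of_pos hn, ← Real.rpow_natCast (_ ^ _),
    ← Real.rpow_mul hn'.le]
  norm_num [Real.rpow_neg_one, div_eq_mul_inv]

end DirichletMeanValue

/-- Mean value theorem for Dirichlet polynomials twisted by Dirichlet characters
(Lemma 2.2, second part): there is an absolute constant `C > 0` such that for every
`X ≥ 2`, every `f : ℕ → ℂ` supported on `[X/2, 4X]`, every integer `q ≥ 2`,
every `T ≥ 2` and `T₀ ∈ ℝ`,
`∑_{χ mod q} ∫_{T₀}^{T₀+T} |∑_n f(n) χ(n) n^{-1/2-it}|² dt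
  ≤ C ((qT+X)/X) (∑_n |f(n)|²) (log(qTX))³`. -/
theorem stmt_1 :
    ∃ C : ℝ, 0 < C ∧
      ∀ (X : ℝ), 2 ≤ X → ∀ f : ℕ → ℂ,
        (∀ n : ℕ, f n ≠ 0 → X / 2 ≤ (n : ℝ) ∧ (n : ℝ) ≤ 4 * X) →
        ∀ (q : ℕ) [NeZero q], 2 ≤ q →
        ∀ (T T₀ : ℝ), 2 ≤ T →
          (∑ χ : DirichletCharacter ℂ q, ∫ t in T₀..(T₀ + T),
              ‖∑' n : ℕ, f n * χ (n : ZMod q) *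
                (n : ℂ) ^ (-(1 / 2 : ℂ) - Complex.I * (t : ℂ))‖ ^ 2)
            ≤ C * (((q : ℝ) * T + X) / X) * (∑' n : ℕ, ‖f n‖ ^ 2) *
                (Real.log ((q : ℝ) * T * X)) ^ 3 := by
  refine ⟨100, by norm_num, fun X hX f hf q _ hq T T₀ hT => ?_⟩
  have hq' : (2 : ℝ) ≤ q := by exact_mod_cast hq
  set N := ⌊4 * X⌋₊
  have hN : (N : ℝ) ≤ 4 * X := Nat.floor_le (by linarith)
  have hN1 : (1 : ℝ) ≤ N := by
    exact_mod_cast Nat.le_floor (by push_cast; linarith : ((1 : ℕ) : ℝ) ≤ 4 * X)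
  set S := (Finset.Icc 1 N).filter fun n : ℕ => X / 2 ≤ (n : ℝ)
  have hS : ∀ n ∈ S, 1 ≤ n ∧ n ≤ N := fun n hn => Finset.mem_Icc.1 (Finset.mem_filter.1 hn).1
  have hf0 : ∀ n ∉ S, f n = 0 := by
    intro n hn
    by_contra h
    obtain ⟨h1, h2⟩ := hf n h
    refine hn (Finset.mem_filter.2 ⟨Finset.mem_Icc.2 ⟨?_, Nat.le_floor h2⟩, h1⟩)
    have : (1 : ℝ) ≤ n := by linarith
    exact_mod_cast this
  have hsum : ∀ (χ : DirichletCharacter ℂ q) (t : ℝ),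
      ∑' n : ℕ, f n * χ (n : ZMod q) * (n : ℂ) ^ (-(1 / 2 : ℂ) - Complex.I * (t : ℂ)) =
      ∑ n ∈ S, f n * (n : ℂ) ^ (-(1 / 2 : ℂ)) * χ n *
        Complex.exp (-Complex.I * Real.log n * t) := by
    intro χ t
    rw [tsum_eq_sum fun n hn => by rw [hf0 n hn, zero_mul, zero_mul]]
    refine Finset.sum_congr rfl fun n hn => ?_
    rw [DirichletMeanValue.natCast_cpow_neg_half_sub (Nat.one_le_iff_ne_zero.1 (hS n hn).1)]
    ring
  have hnorm : ∑' n : ℕ, ‖f n‖ ^ 2 = ∑ n ∈ S, ‖f n‖ ^ 2 :=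
    tsum_eq_sum fun n hn => by rw [hf0 n hn]; simp
  simp only [hsum, hnorm]
  have hcoef : ∑ n ∈ S, ‖f n * (n : ℂ) ^ (-(1 / 2 : ℂ))‖ ^ 2 ≤ 2 / X * ∑ n ∈ S, ‖f n‖ ^ 2 := by
    rw [Finset.mul_sum]
    refine Finset.sum_le_sum fun n hn => ?_
    rw [DirichletMeanValue.norm_sq_mul_natCast_cpow_neg_half _ (hS n hn).1]
    have h := (Finset.mem_filter.1 hn).2
    calc ‖f n‖ ^ 2 / n ≤ ‖f n‖ ^ 2 / (X / 2) := by gcongr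
      _ = 2 / X * ‖f n‖ ^ 2 := by field_simp
  set L := Real.log ((q : ℝ) * T * X)
  have h4X : 4 * X ≤ q * T * X := by
    gcongr
    nlinarith
  have hNL : Real.log N ≤ L := Real.log_le_log (by linarith) (hN.trans h4X)
  have hL : 1 ≤ L := by
    rw [Real.le_log_iff_exp_le (by linarith)]
    have := Real.exp_one_lt_d9
    linarith
  have hL3 : L ≤ L ^ 3 := le_self_pow₀ hL (by norm_num)
  have hlogN : 0 ≤ Real.log N := Real.log_nonneg hN1
  have hF : 0 ≤ ∑ n ∈ S, ‖f n‖ ^ 2 := by positivity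
  calc _ ≤ (q * T + 4 * N * (1 + Real.log N)) *
        ∑ n ∈ S, ‖f n * (n : ℂ) ^ (-(1 / 2 : ℂ))‖ ^ 2 :=
        DirichletMeanValue.sum_integral_norm_sq_le S hS _ T₀ (by linarith)
    _ ≤ (q * T * L ^ 3 + 4 * (4 * X) * (L ^ 3 + L ^ 3)) * (2 / X * ∑ n ∈ S, ‖f n‖ ^ 2) := by
        have hqT : q * T ≤ q * T * L ^ 3 :=
          le_mul_of_one_le_right (by positivity) (hL.trans hL3)
        refine mul_le_mul (add_le_add hqT ?_) hcoef (by positivity) (by positivity)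
        gcongr
        · exact hL.trans hL3
        · exact hNL.trans hL3
    _ = (2 * (q * T) + 64 * X) / X * (∑ n ∈ S, ‖f n‖ ^ 2) * L ^ 3 := by
        field_simp
        ring
    _ ≤ (100 * (q * T + X)) / X * (∑ n ∈ S, ‖f n‖ ^ 2) * L ^ 3 := by
        have : 0 ≤ (q : ℝ) * T := by positivity
        gcongr
        linarith
    _ = 100 * ((q * T + X) / X) * (∑ n ∈ S, ‖f n‖ ^ 2) * L ^ 3 := by
        rw [mul_div_assoc]
end

section
/- Let λ be an arithmetic function with λ(1) = 1, let μ_λ be its Dirichlet-convolution inverse (so λ * μ_λ = ε), and define Λ_λ := (λ·log) * μ_λ, where (λ·log)(n) := λ(n) log n. Let L ≥ 1 and z ≥ 1 be integers. Then for every integer n with 1 ≤ n ≤ z^L one has Λ_λ(n) = Σ_{ℓ=1}^{L} (−1)^{ℓ−1} (L choose ℓ) Σ λ(m₁)(log m₁) λ(m₂) ⋯ λ(m_ℓ) μ_λ(n₁) ⋯ μ_λ(n_ℓ), where the inner sum runs over all tuples of positive integers (m₁, …, m_ℓ, n₁, …, n_ℓ) with m₁⋯m_ℓ · n₁⋯n_ℓ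 = n and n_j ≤ z for every 1 ≤ j ≤ ℓ. -/
open scoped ArithmeticFunction

/-- The complex-valued arithmetic function `n ↦ log n`. -/
noncomputable def clog : ArithmeticFunction ℂ :=
  ⟨fun n => (Real.log n : ℂ), by simp⟩

namespace ArithmeticFunction

variable {R : Type*}

/-- The restriction of an arithmetic function to the integers `n ≤ z`. -/
def truncate [Zero R] (f : ArithmeticFunction R) (z : ℕ) : ArithmeticFunction R :=
  ⟨fun n => if n ≤ z then f n else 0, by simp⟩

theorem truncate_apply [Zero R] (f : ArithmeticFunction R) (z n : ℕ) :
    f.truncate z n = if n ≤ z then f n else 0 := rfl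

theorem mul_apply_eq_zero_of_lt [Semiring R] {f g : ArithmeticFunction R} {a b : ℕ}
    (hf : ∀ n < a, f n = 0) (hg : ∀ n < b, g n = 0) {n : ℕ} (hn : n < a * b) :
    (f * g) n = 0 := by
  rw [mul_apply]
  refine Finset.sum_eq_zero fun p hp => ?_
  rw [← (Nat.mem_divisorsAntidiagonal.mp hp).1] at hn
  by_cases h : p.1 < a
  · simp [hf _ h]
  · have h' : p.2 < b := by
      by_contra h'
      exact absurd (Nat.mul_le_mul (not_lt.mp h) (not_lt.mp h')) (not_le.mpr hn)
    simp [hg _ h']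

theorem pow_apply_eq_zero_of_lt [Semiring R] {f : ArithmeticFunction R} {a : ℕ}
    (hf : ∀ n < a, f n = 0) (k : ℕ) {n : ℕ} (hn : n < a ^ k) : (f ^ k) n = 0 := by
  induction k generalizing n with
  | zero =>
    obtain rfl : n = 0 := by simpa using hn
    exact ArithmeticFunction.map_zero
  | succ k ih =>
    rw [pow_succ]
    exact mul_apply_eq_zero_of_lt (fun m hm => ih hm) hf (by rwa [← pow_succ])

/-- Convolving two arithmetic functions that are given as sums over the fibres of maps to `ℕ`. -/
theorem mul_apply_eq_sum_fibers [Semiring R] {α β : Type*} {F G : ArithmeticFunction R} {N : ℕ}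
    {S : Finset α} {T : Finset β} {φ : α → ℕ} {ψ : β → ℕ} {u : α → R} {v : β → R}
    (hF : ∀ a, a ≠ 0 → a ≤ N → F a = ∑ x ∈ S, if φ x = a then u x else 0)
    (hG : ∀ b, b ≠ 0 → b ≤ N → G b = ∑ y ∈ T, if ψ y = b then v y else 0)
    {n : ℕ} (hn : n ≠ 0) (hnN : n ≤ N) :
    (F * G) n = ∑ x ∈ S, ∑ y ∈ T, if φ x * ψ y = n then u x * v y else 0 := by
  have key : ∀ p ∈ n.divisorsAntidiagonal, F p.1 * G p.2 =
      ∑ x ∈ S, ∑ y ∈ T, if (φ x, ψ y) = p then u x * v y else 0 := by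
    rintro ⟨a, b⟩ hp
    obtain ⟨rfl, -⟩ := Nat.mem_divisorsAntidiagonal.mp hp
    obtain ⟨ha, hb⟩ := mul_ne_zero_iff.mp hn
    have h1 : a ≤ N := (Nat.le_mul_of_pos_right a (Nat.pos_of_ne_zero hb)).trans hnN
    have h2 : b ≤ N := (Nat.le_mul_of_pos_left b (Nat.pos_of_ne_zero ha)).trans hnN
    rw [hF a ha h1, hG b hb h2, Finset.sum_mul_sum]
    refine Finset.sum_congr rfl fun x _ => Finset.sum_congr rfl fun y _ => ?_
    simp only [Prod.mk.injEq]
    split_ifs <;> simp_all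
  rw [mul_apply, Finset.sum_congr rfl key, Finset.sum_comm]
  refine Finset.sum_congr rfl fun x _ => ?_
  rw [Finset.sum_comm]
  refine Finset.sum_congr rfl fun y _ => ?_
  rw [Finset.sum_ite_eq]
  simp [Nat.mem_divisorsAntidiagonal, hn]

/-- A finite Dirichlet product as a sum over factorizations. -/
theorem prod_apply_eq_sum [CommSemiring R] {k : ℕ} (f : Fin k → ArithmeticFunction R) {N n : ℕ}
    (hn : n ≠ 0) (hnN : n ≤ N) :
    (∏ i, f i) n = ∑ x ∈ Fintype.piFinset fun _ : Fin k => Finset.range (N + 1),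
      if ∏ i, x i = n then ∏ i, f i (x i) else 0 := by
  induction k generalizing n with
  | zero => simp [one_apply, eq_comm]
  | succ k ih =>
    have h0 : ∀ a, a ≠ 0 → a ≤ N →
        f 0 a = ∑ x ∈ Finset.range (N + 1), if x = a then f 0 x else 0 := by
      intro a _ ha
      rw [Finset.sum_ite_eq', if_pos (Finset.mem_range.mpr (by lia))]
    rw [Fin.prod_univ_succ,
      mul_apply_eq_sum_fibers h0 (fun b hb hbN => ih (fun i => f i.succ) hb hbN) hn hnN,
      ← Finset.sum_product']
    refine Finset.sum_equiv (Fin.consEquiv fun _ => ℕ) (fun p => ?_) (fun p _ => ?_)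
    · simp [Fin.forall_fin_succ]
    · simp [Fin.prod_univ_succ]

/-- The algebraic form of the Heath-Brown identity. -/
theorem apply_eq_sum_truncate [CommRing R] {f g h : ArithmeticFunction R} (hfg : f * g = 1)
    {L z n : ℕ} (hL : L ≠ 0) (hn : n ≤ z ^ L) :
    (h * g) n = ∑ j ∈ Finset.range L, (-1) ^ j * (L.choose (j + 1) : R) *
      ((h * f ^ j) * g.truncate z ^ (j + 1)) n := by
  set M := g.truncate z with hM
  have hvan : ∀ m < z + 1, (g - M) m = 0 := fun m hm => by
    have : (g - M) m = g m - M m := by simp [sub_eq_add_neg]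
    rw [this, hM, truncate_apply, if_pos (by lia), sub_self]
  have hzero : ((h * g) * (1 - f * M) ^ L) n = 0 := by
    have e : (h * g) * (1 - f * M) ^ L = (h * g * f ^ L) * (g - M) ^ L := by
      rw [← hfg, ← mul_sub, mul_pow, mul_assoc (h * g)]
    rw [e]
    refine mul_apply_eq_zero_of_lt (a := 1) (fun m hm => ?_)
      (fun m hm => pow_apply_eq_zero_of_lt hvan L hm) ?_
    · obtain rfl : m = 0 := by lia
      exact ArithmeticFunction.map_zero
    · rw [one_mul]
      exact hn.trans_lt (Nat.pow_lt_pow_left (Nat.lt_succ_self z) hL)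
  have hexp : (h * g) * (1 - f * M) ^ L = h * g -
      ∑ j ∈ Finset.range L, ((-1) ^ j * (L.choose (j + 1) : ℤ)) •
        ((h * f ^ j) * M ^ (j + 1)) := by
    rw [sub_eq_add_neg 1, add_comm, add_pow, Finset.sum_range_succ', mul_add, Finset.mul_sum,
      add_comm, sub_eq_add_neg, ← Finset.sum_neg_distrib]
    congr 1
    · simp
    · refine Finset.sum_congr rfl fun j _ => ?_
      rw [zsmul_eq_mul]
      push_cast
      linear_combination (-1) ^ (j + 1) * (L.choose (j + 1) : ArithmeticFunction R) * h *
        f ^ j * M ^ (j + 1) * hfg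
  let ev : ArithmeticFunction R →+ R :=
    { toFun := fun F => F n, map_zero' := rfl, map_add' := fun _ _ => rfl }
  have hev : ∀ F : ArithmeticFunction R, F n = ev F := fun _ => rfl
  rw [hev, hexp, map_sub, map_sum, sub_eq_zero] at hzero
  simp only [hev]
  rw [hzero]
  refine Finset.sum_congr rfl fun j _ => ?_
  rw [map_zsmul, zsmul_eq_mul]
  push_cast
  rfl

end ArithmeticFunction

/-- Heath-Brown's identity (from the proof of Lemma 2.3), for a general arithmetic
function `λ` with `λ(1) = 1`, its Dirichlet-convolution inverse `μ_λ`
(so `λ * μ_λ = ε`) and `Λ_λ := (λ·log) * μ_λ`: for all integers `L ≥ 1`, `z ≥ 1`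
and all `1 ≤ n ≤ z^L`,
`Λ_λ(n) = ∑_{ℓ=1}^{L} (-1)^{ℓ-1} (L choose ℓ)
  ∑_{m₁⋯m_ℓ n₁⋯n_ℓ = n, n_j ≤ z} λ(m₁) log(m₁) λ(m₂) ⋯ λ(m_ℓ) μ_λ(n₁) ⋯ μ_λ(n_ℓ)`
(here the outer sum is reindexed by `ℓ = j + 1`, `j ∈ {0, …, L-1}`). -/
theorem stmt_4 (lam mu Lam : ArithmeticFunction ℂ)
    (hlam1 : lam 1 = 1) (hmu : lam * mu = 1)
    (hLam : Lam = lam.pmul clog * mu)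
    (L z : ℕ) (hL : 1 ≤ L) (hz : 1 ≤ z)
    (n : ℕ) (hn : 1 ≤ n) (hnz : n ≤ z ^ L) :
    Lam n = ∑ j ∈ Finset.range L, (-1 : ℂ) ^ j * (L.choose (j + 1) : ℂ) *
      ∑' p : (Fin (j + 1) → ℕ) × (Fin (j + 1) → ℕ),
        if (∏ i, p.1 i) * (∏ i, p.2 i) = n ∧ ∀ i, p.2 i ≤ z then
          (Real.log (p.1 0) : ℂ) * (∏ i, lam (p.1 i)) * (∏ i, mu (p.2 i))
        else 0 := by
  subst hLam
  rw [ArithmeticFunction.apply_eq_sum_truncate hmu (by lia) hnz]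
  refine Finset.sum_congr rfl fun j _ => ?_
  congr 1
  have hn0 : n ≠ 0 := by lia
  set B := Fintype.piFinset fun _ : Fin (j + 1) => Finset.range (n + 1) with hB
  have hmem : ∀ x : Fin (j + 1) → ℕ, ∏ i, x i ∣ n → x ∈ B := fun x hx =>
    Fintype.mem_piFinset.mpr fun i => Finset.mem_range.mpr <| Nat.lt_succ_of_le <|
      Nat.le_of_dvd hn ((Finset.dvd_prod_of_mem x (Finset.mem_univ i)).trans hx)
  rw [tsum_eq_sum (s := B ×ˢ B), Finset.sum_product]
  · have h1 : lam.pmul clog * lam ^ j =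
        ∏ i, (Fin.cons (lam.pmul clog) fun _ => lam : Fin (j + 1) → ArithmeticFunction ℂ) i := by
      simp [Fin.prod_univ_succ]
    have h2 : mu.truncate z ^ (j + 1) = ∏ _i : Fin (j + 1), mu.truncate z := by simp
    rw [h1, h2, ArithmeticFunction.mul_apply_eq_sum_fibers
      (fun a ha haN => ArithmeticFunction.prod_apply_eq_sum _ ha haN)
      (fun b hb hbN => ArithmeticFunction.prod_apply_eq_sum _ hb hbN) hn0 le_rfl]
    refine Finset.sum_congr rfl fun x _ => Finset.sum_congr rfl fun y _ => ?_
    have h3 : ∏ i, mu.truncate z (y i) = if ∀ i, y i ≤ z then ∏ i, mu (y i) else 0 := by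
      simp [ArithmeticFunction.truncate_apply, Finset.prod_ite_zero]
    have h4 : clog (x 0) = (Real.log (x 0) : ℂ) := rfl
    rw [h3, ite_and]
    simp only [Fin.prod_univ_succ (n := j), Fin.cons_zero, Fin.cons_succ,
      ArithmeticFunction.pmul_apply, h4]
    split_ifs <;> ring
  · rintro ⟨x, y⟩ hp
    refine if_neg fun h => hp (Finset.mem_product.mpr ⟨hmem x ?_, hmem y ?_⟩)
    · exact ⟨_, h.1.symm⟩
    · exact ⟨_, (mul_comm _ _).trans h.1 |>.symm⟩
end

section
/- Let λ be an arithmetic function with λ(1) = 1, let μ_λ be its Dirichlet-convolution inverse (so λ * μ_λ = ε), and define Λ_λ := (λ·log) * μ_λ, where (λ·log)(n) := λ(n) log n. For a real number Z ≥ 0 and an arithmetic function g, write g_{≤Z}(n) := g(n) if n ≤ Z and g_{≤Z}(n) := 0 otherwise, and g_{>Z} := g − g_{≤Z}. Then for all real U, V ≥ 1 one has the identity of arithmetic functions: Λ_λ = Λ_λ,{≤U} + (λ·log) * μ_λ,{≤V} − λ * μ_λ,{≤V} * Λ_λ,{≤U} + Λ_λ,{>U} * λ * μ_λ,{>V}, i.e.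 for every positive integer n, Λ_λ(n) = (Λ_λ)_{≤U}(n) + ((λ·log) * (μ_λ)_{≤V})(n) − (λ * (μ_λ)_{≤V} * (Λ_λ)_{≤U})(n) + ((Λ_λ)_{>U} * λ * (μ_λ)_{>V})(n). -/
/-- The truncation `g_{≤Z}` of an arithmetic function `g`:
`g_{≤Z}(n) = g(n)` if `n ≤ Z` and `0` otherwise. -/
noncomputable def trunc (g : ArithmeticFunction ℂ) (Z : ℝ) : ArithmeticFunction ℂ :=
  ⟨fun n => if (n : ℝ) ≤ Z then g n else 0, by simp⟩

/-- Vaughan's identity for `Λ_λ` (used in the proof of Lemma 2.6), for a general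
arithmetic function `λ` with `λ(1) = 1`, its Dirichlet-convolution inverse `μ_λ`
(so `λ * μ_λ = ε`) and `Λ_λ := (λ·log) * μ_λ`: for all `U, V ≥ 1`,
`Λ_λ = Λ_λ,{≤U} + (λ·log) * μ_λ,{≤V} - λ * μ_λ,{≤V} * Λ_λ,{≤U}
  + Λ_λ,{>U} * λ * μ_λ,{>V}`, where `g_{>Z} := g - g_{≤Z}`. -/
theorem stmt_16 (lam mu Lam : ArithmeticFunction ℂ)
    (hlam1 : lam 1 = 1) (hmu : lam * mu = 1)
    (hLam : Lam = lam.pmul clog * mu)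
    (U V : ℝ) (hU : 1 ≤ U) (hV : 1 ≤ V) :
    Lam = trunc Lam U + lam.pmul clog * trunc mu V
        - lam * trunc mu V * trunc Lam U
        + (Lam - trunc Lam U) * lam * (mu - trunc mu V) := by
  linear_combination (lam.pmul clog * trunc mu V - (Lam - trunc Lam U)) * hmu + lam * trunc mu V * hLam
end
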